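/- Let ρ : 𝔞 → End(V) be a Lie algebra homomorphism and η ∈ ℋ_ρ(V). Then for every a ∈ ℂ: (i) aη ∈ ℋ_ρ(V); (ii) η − aρ ∈ ℋ_ρ(V); (iii) aρ ∈ ℋ_ρ(V). -/

import Mathlib

open TensorAlgebra TensorProduct Polynomial

noncomputable section

/-- The graded pieces `F^r(a)` of the free Lie algebra on the vector space `a`,
realized inside the tensor algebra `T(a)`:  `F¹(a) = ι(a)` and `F^{r+1}(a)` is spanned by
the commutators `ι(x) * y - y * ι(x)` with `x ∈ a`, `y ∈ F^r(a)`. -/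
def Fr (a : Type*) [LieRing a] [LieAlgebra ℂ a] : ℕ → Submodule ℂ (TensorAlgebra ℂ a)
  | 0 => ⊥
  | 1 => LinearMap.range (TensorAlgebra.ι ℂ (M := a))
  | (r + 2) => Submodule.span ℂ
      {u | ∃ (x : a) (y : TensorAlgebra ℂ a), y ∈ Fr a (r + 1) ∧
        u = TensorAlgebra.ι ℂ x * y - y * TensorAlgebra.ι ℂ x}

/-- The free Lie algebra `F(a) = ⊕_{r>0} F^r(a)` on the vector space `a`,
as a subspace of the tensor algebra. -/
def FLie (a : Type*) [LieRing a] [LieAlgebra ℂ a] : Submodule ℂ (TensorAlgebra ℂ a) :=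
  ⨆ r, Fr a r

/-- `IsTau a τ` says that the linear map `τ` is (a linear extension to `T(a)` of) the canonical
Lie algebra homomorphism `τ : F(a) → a`: it is the identity on `F¹(a) = a` and takes the
commutator bracket of `T(a)` (restricted to `F(a)`) to the bracket of `a`. -/
def IsTau (a : Type*) [LieRing a] [LieAlgebra ℂ a] (τ : TensorAlgebra ℂ a →ₗ[ℂ] a) : Prop :=
  (∀ x : a, τ (TensorAlgebra.ι ℂ x) = x) ∧
  ∀ r s : ℕ, ∀ u ∈ Fr a r, ∀ v ∈ Fr a s, τ (u * v - v * u) = ⁅τ u, τ v⁆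

/-- The current algebra `a[t] = a ⊗ ℂ[t]`, with bracket `⁅x ⊗ f, y ⊗ g⁆ = ⁅x, y⁆ ⊗ fg`. -/
abbrev Cur (a : Type*) [LieRing a] [LieAlgebra ℂ a] : Type _ := Polynomial ℂ ⊗[ℂ] a

/-- `IsTauT a τ τt` says that the linear map `τt` is (a linear extension to `T(a)` of) the map
`τ[t] : F(a) → a[t]` given by `τ[t](𝐱) = τ(𝐱) ⊗ t^r` for `𝐱 ∈ F^r(a)`. -/
def IsTauT (a : Type*) [LieRing a] [LieAlgebra ℂ a] (τ : TensorAlgebra ℂ a →ₗ[ℂ] a)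
    (τt : TensorAlgebra ℂ a →ₗ[ℂ] Cur a) : Prop :=
  ∀ r : ℕ, ∀ u ∈ Fr a r, τt u = ((X : ℂ[X]) ^ r) ⊗ₜ[ℂ] (τ u)

end

noncomputable section

/-- `MemH a V τ ρ η`, i.e. `(ρ, η) ∈ ℋ(V)`:  `ρ` is a Lie algebra homomorphism (C1), `η` is a
homomorphism of `a`-modules for the `a`-module structure on `End V` induced by `ρ` (C2), and
`ker τ_r ⊆ ker η^{⊙r}` for all `r > 0` (C3), where `η^{⊙r}` is the restriction to
`F^r(a) ⊆ T^r(a)` of the algebra homomorphism `η_T : T(a) → End V` extending `η`. -/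
def MemH (a : Type*) [LieRing a] [LieAlgebra ℂ a] {V : Type*} [AddCommGroup V] [Module ℂ V]
    (τ : TensorAlgebra ℂ a →ₗ[ℂ] a) (ρ η : a →ₗ[ℂ] Module.End ℂ V) : Prop :=
  (∀ x y : a, ρ ⁅x, y⁆ = ⁅ρ x, ρ y⁆) ∧
  (∀ x y : a, η ⁅x, y⁆ = ⁅ρ x, η y⁆) ∧
  (∀ r : ℕ, ∀ u ∈ Fr a r, τ u = 0 → TensorAlgebra.lift ℂ η u = 0)

/-- `IsCurHom a ρ₁ η₁ ρ₂ η₂ φ` says that the linear map `φ : V₁ → V₂` is a homomorphism of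
`a[t]`-modules from `V₁(ρ₁, η₁)` to `V₂(ρ₂, η₂)`: it intertwines the actions of `x ⊗ 1`
(given by `ρᵢ`) and of `x ⊗ t^r` (given by `ηᵢ^{⊙r}(𝐱)` for `𝐱 ∈ F^r(a)` with `τ_r(𝐱) = x`). -/
def IsCurHom (a : Type*) [LieRing a] [LieAlgebra ℂ a]
    {V1 V2 : Type*} [AddCommGroup V1] [Module ℂ V1] [AddCommGroup V2] [Module ℂ V2]
    (ρ1 η1 : a →ₗ[ℂ] Module.End ℂ V1) (ρ2 η2 : a →ₗ[ℂ] Module.End ℂ V2)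
    (φ : V1 →ₗ[ℂ] V2) : Prop :=
  (∀ x : a, φ ∘ₗ ρ1 x = ρ2 x ∘ₗ φ) ∧
  ∀ r : ℕ, ∀ u ∈ Fr a r,
    φ ∘ₗ (TensorAlgebra.lift ℂ η1 u : Module.End ℂ V1)
      = (TensorAlgebra.lift ℂ η2 u : Module.End ℂ V2) ∘ₗ φ

end

section CurrentAlgebra

attribute [local instance] LieRing.ofAssociativeRing LieAlgebra.ofAssociativeAlgebra

variable {a : Type*} [LieRing a] [LieAlgebra ℂ a] {V : Type*} [AddCommGroup V] [Module ℂ V]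
  {τ : TensorAlgebra ℂ a →ₗ[ℂ] a}

theorem ι_mem_Fr_one (x : a) : TensorAlgebra.ι ℂ x ∈ Fr a 1 := by
  rw [Fr]
  exact ⟨x, rfl⟩

theorem commutator_mem_Fr (x : a) {r : ℕ} {u : TensorAlgebra ℂ a} (hu : u ∈ Fr a (r + 1)) :
    TensorAlgebra.ι ℂ x * u - u * TensorAlgebra.ι ℂ x ∈ Fr a (r + 2) := by
  rw [Fr]
  exact Submodule.subset_span ⟨x, u, hu, rfl⟩

theorem IsTau.apply_commutator (hτ : IsTau a τ) (x : a) {r : ℕ} {u : TensorAlgebra ℂ a}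
    (hu : u ∈ Fr a r) :
    τ (TensorAlgebra.ι ℂ x * u - u * TensorAlgebra.ι ℂ x) = ⁅x, τ u⁆ := by
  rw [hτ.2 1 r _ (ι_mem_Fr_one x) u hu, hτ.1]

/-- If `a` is perfect, each `τ_r` with `r > 0` is surjective. -/
theorem IsTau.exists_mem_Fr (h𝔞 : Submodule.span ℂ {z : a | ∃ x y : a, z = ⁅x, y⁆} = ⊤)
    (hτ : IsTau a τ) (r : ℕ) (z : a) : ∃ u ∈ Fr a (r + 1), τ u = z := by
  induction r generalizing z with
  | zero => exact ⟨_, ι_mem_Fr_one z, hτ.1 z⟩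
  | succ r ih =>
    have hle : Submodule.span ℂ {z : a | ∃ x y : a, z = ⁅x, y⁆} ≤ (Fr a (r + 2)).map τ := by
      rw [Submodule.span_le]
      rintro _ ⟨x, y, rfl⟩
      obtain ⟨u, hu, rfl⟩ := ih y
      exact ⟨_, commutator_mem_Fr x hu, hτ.apply_commutator x hu⟩
    rw [h𝔞] at hle
    exact hle Submodule.mem_top

/-- The map `η^{⊙r}` factors through `τ_r` as soon as `ker τ_r ⊆ ker η^{⊙r}`. -/
theorem exists_lift_eq_comp_tau (h𝔞 : Submodule.span ℂ {z : a | ∃ x y : a, z = ⁅x, y⁆} = ⊤)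
    (hτ : IsTau a τ) {η : a →ₗ[ℂ] Module.End ℂ V}
    (hη : ∀ r : ℕ, ∀ u ∈ Fr a r, τ u = 0 → TensorAlgebra.lift ℂ η u = 0) (r : ℕ) :
    ∃ f : a →ₗ[ℂ] Module.End ℂ V, ∀ u ∈ Fr a (r + 1), TensorAlgebra.lift ℂ η u = f (τ u) := by
  obtain ⟨s, hs⟩ := (τ.domRestrict (Fr a (r + 1))).exists_rightInverse_of_surjective (by
    rw [LinearMap.range_eq_top]
    intro z
    obtain ⟨u, hu, h⟩ := hτ.exists_mem_Fr h𝔞 r z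
    exact ⟨⟨u, hu⟩, h⟩)
  refine ⟨(TensorAlgebra.lift ℂ η).toLinearMap ∘ₗ (Fr a (r + 1)).subtype ∘ₗ s, fun u hu => ?_⟩
  have hs' : τ (s (τ u)) = τ u := LinearMap.congr_fun hs (τ u)
  have h := hη (r + 1) (u - s (τ u)) (Submodule.sub_mem _ hu (s (τ u)).2) (by
    rw [map_sub, hs', sub_self])
  rw [map_sub, sub_eq_zero] at h
  exact h

/-- Condition (C3) holds for `μ` if there are linear maps `E r`, to be thought of as the action
of `a ⊗ p ^ r`, which start from `μ` and are compatible with bracketing by `μ`. -/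
theorem lift_eq_of_bracket (hτ : IsTau a τ) {μ : a →ₗ[ℂ] Module.End ℂ V}
    {E : ℕ → a →ₗ[ℂ] Module.End ℂ V} (h1 : E 1 = μ)
    (hE : ∀ r x y, ⁅μ x, E r y⁆ = E (r + 1) ⁅x, y⁆) (r : ℕ) {u : TensorAlgebra ℂ a}
    (hu : u ∈ Fr a (r + 1)) : TensorAlgebra.lift ℂ μ u = E (r + 1) (τ u) := by
  induction r generalizing u with
  | zero =>
    rw [Fr] at hu
    obtain ⟨x, rfl⟩ := hu
    rw [TensorAlgebra.lift_ι_apply, hτ.1, zero_add, h1]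
  | succ r ih =>
    rw [Fr] at hu
    induction hu using Submodule.span_induction with
    | mem u hu =>
      obtain ⟨x, y, hy, rfl⟩ := hu
      rw [hτ.apply_commutator x hy, ← hE, map_sub, map_mul, map_mul, ih hy,
        TensorAlgebra.lift_ι_apply, Ring.lie_def]
    | zero => simp
    | add u v _ _ hu hv => rw [map_add, map_add, map_add, hu, hv]
    | smul k u _ hu => rw [map_smul, map_smul, map_smul, hu]

/-- A pair `(ρ, η) ∈ ℋ(V)` gives operators `e r x`, the action of `x ⊗ t ^ r`. -/
theorem MemH.exists_current_action
    (h𝔞 : Submodule.span ℂ {z : a | ∃ x y : a, z = ⁅x, y⁆} = ⊤) (hτ : IsTau a τ)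
    {ρ η : a →ₗ[ℂ] Module.End ℂ V} (h : MemH a τ ρ η) :
    ∃ e : ℕ → a →ₗ[ℂ] Module.End ℂ V, e 0 = ρ ∧ e 1 = η ∧
      (∀ r x y, ⁅ρ x, e r y⁆ = e r ⁅x, y⁆) ∧ ∀ r x y, ⁅η x, e r y⁆ = e (r + 1) ⁅x, y⁆ := by
  obtain ⟨hρ, hρη, hη⟩ := h
  choose f hf using exists_lift_eq_comp_tau h𝔞 hτ hη
  have hf0 : f 0 = η := by
    ext1 x
    rw [← TensorAlgebra.lift_ι_apply η x, hf 0 _ (ι_mem_Fr_one x), hτ.1]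
  have hηf : ∀ r x y, ⁅η x, f r y⁆ = f (r + 1) ⁅x, y⁆ := by
    intro r x y
    obtain ⟨u, hu, rfl⟩ := hτ.exists_mem_Fr h𝔞 r y
    rw [← hτ.apply_commutator x hu, ← hf (r + 1) _ (commutator_mem_Fr x hu), map_sub, map_mul,
      map_mul, hf r u hu, TensorAlgebra.lift_ι_apply, Ring.lie_def]
  have hρf : ∀ r x y, ⁅ρ x, f r y⁆ = f r ⁅x, y⁆ := by
    intro r
    induction r with
    | zero =>
      intro x y
      rw [hf0, hρη]
    | succ r ih =>
      intro x y
      have hy : y ∈ Submodule.span ℂ {z : a | ∃ x y : a, z = ⁅x, y⁆} := h𝔞 ▸ Submodule.mem_top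
      induction hy using Submodule.span_induction with
      | mem y hy =>
        obtain ⟨z, w, rfl⟩ := hy
        rw [← hηf, leibniz_lie, ← hρη, ih, hηf, hηf, ← map_add, ← leibniz_lie]
      | zero => simp
      | add y z _ _ hy hz => rw [map_add, lie_add, lie_add, map_add, hy, hz]
      | smul k y _ hy => rw [map_smul, lie_smul, lie_smul, map_smul, hy]
  refine ⟨fun r => Nat.casesOn r ρ f, rfl, hf0, ?_, ?_⟩
  · rintro (_ | r) x y
    · exact (hρ x y).symm
    · exact hρf r x y
  · rintro (_ | r) x y
    · change ⁅η x, ρ y⁆ = f 0 ⁅x, y⁆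
      rw [hf0, ← lie_skew, ← hρη, ← map_neg, lie_skew]
    · exact hηf r x y

/-- Substituting `b t + c` for `t` in the current algebra action. -/
theorem MemH.smul_add_smul (h𝔞 : Submodule.span ℂ {z : a | ∃ x y : a, z = ⁅x, y⁆} = ⊤)
    (hτ : IsTau a τ) {ρ η : a →ₗ[ℂ] Module.End ℂ V} (h : MemH a τ ρ η) (b c : ℂ) :
    MemH a τ ρ (b • η + c • ρ) := by
  obtain ⟨e, he0, he1, hρe, hηe⟩ := h.exists_current_action h𝔞 hτ
  obtain ⟨hρ, hρη, -⟩ := h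
  refine ⟨hρ, fun x y => ?_, ?_⟩
  · simp only [LinearMap.add_apply, LinearMap.smul_apply, lie_add, lie_smul, hρ, hρη]
  let Φ : ℂ[X] →ₗ[ℂ] a →ₗ[ℂ] Module.End ℂ V := (Polynomial.basisMonomials ℂ).constr ℂ e
  have hΦ : ∀ n, Φ (X ^ n) = e n := by
    intro n
    rw [← (Polynomial.basisMonomials ℂ).constr_basis ℂ e n, Polynomial.coe_basisMonomials,
      Polynomial.X_pow_eq_monomial]
  have key : ∀ (p : ℂ[X]) (x y : a), ⁅(b • η + c • ρ) x, Φ p y⁆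
      = Φ (p * (C b * X + C c)) ⁅x, y⁆ := by
    intro p x y
    induction p using Polynomial.induction_on' with
    | add p q hp hq =>
      rw [add_mul, map_add, map_add, LinearMap.add_apply (Φ p), lie_add, hp, hq,
        LinearMap.add_apply]
    | monomial n k =>
      have h1 : (monomial n k : ℂ[X]) = k • X ^ n := by
        rw [Polynomial.smul_X_eq_monomial]
      have h2 : (k • X ^ n : ℂ[X]) * (C b * X + C c) = k • (b • X ^ (n + 1) + c • X ^ n) := by
        simp only [Polynomial.smul_eq_C_mul]
        ring
      rw [h1, h2]
      simp only [map_add, map_smul, hΦ, LinearMap.add_apply, LinearMap.smul_apply, add_lie,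
        lie_smul, smul_lie, hρe, hηe]
  rintro (_ | r) u hu hu0
  · rw [Fr, Submodule.mem_bot] at hu
    rw [hu, map_zero]
  · rw [lift_eq_of_bracket hτ (E := fun n => Φ ((C b * X + C c) ^ n)) _ _ r hu, hu0, map_zero]
    · have h1 : (C b * X + C c : ℂ[X]) = b • X ^ 1 + c • X ^ 0 := by
        simp only [Polynomial.smul_eq_C_mul, pow_one, pow_zero, mul_one]
      rw [pow_one, h1, map_add, map_smul, map_smul, hΦ, hΦ, he0, he1]
    · intro n x y
      rw [key, pow_succ]

end CurrentAlgebra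

/-- Let `ρ : a → End V` be a Lie algebra homomorphism and `η ∈ ℋ_ρ(V)`.
Then for every `c ∈ ℂ`:  (i) `cη ∈ ℋ_ρ(V)`;  (ii) `η - cρ ∈ ℋ_ρ(V)`;  (iii) `cρ ∈ ℋ_ρ(V)`. -/
theorem statement6 (a : Type*) [LieRing a] [LieAlgebra ℂ a]
    (h𝔞 : Submodule.span ℂ {z : a | ∃ x y : a, z = ⁅x, y⁆} = ⊤)
    (V : Type*) [AddCommGroup V] [Module ℂ V]
    (τ : TensorAlgebra ℂ a →ₗ[ℂ] a) (hτ : IsTau a τ)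
    (ρ η : a →ₗ[ℂ] Module.End ℂ V) (hη : MemH a τ ρ η) (c : ℂ) :
    MemH a τ ρ (c • η) ∧ MemH a τ ρ (η - c • ρ) ∧ MemH a τ ρ (c • ρ) := by
  refine ⟨?_, ?_, ?_⟩
  · simpa using hη.smul_add_smul h𝔞 hτ c 0
  · have h : η - c • ρ = (1 : ℂ) • η + (-c) • ρ := by
      ext x v
      simp [sub_eq_add_neg]
    exact h ▸ hη.smul_add_smul h𝔞 hτ 1 (-c)
  · simpa using hη.smul_add_smul h𝔞 hτ 0 c
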